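/- Given C > 0 and ε > 0 there is some δ > 0 such that: for any smooth (C^∞) function A : ℝ → M₂(ℝ) with tr A(t) = 0 and ‖A(t)‖ ≤ C for all t ∈ ℝ, and any matrix S ∈ M₂(ℝ) with det S = 1 and ‖S − I‖ ≤ δ, there exists a smooth function B : ℝ → M₂(ℝ) with tr B(t) = 0 for all t, such that: (1) ‖A(t) − B(t)‖ ≤ ε for all t ∈ ℝ; (2) A(t) = B(t) for all t ∉ (0,1); and (3) Φ_B(1) = Φ_A(1)·S, where Φ_A and Φ_B denote the fundamental solutions of the linear equations u' = A(t)u and u' = B(t)u respectively. -/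

import Mathlib

open Set

/-- The Euclidean plane. -/
abbrev E2 : Type := EuclideanSpace ℝ (Fin 2)

/-- Continuous linear endomorphisms of the Euclidean plane
(2×2 real matrices with the operator norm). -/
abbrev M2 : Type := E2 →L[ℝ] E2

/-- The trace of a 2×2 real matrix. -/
noncomputable def trM2 (T : M2) : ℝ := LinearMap.trace ℝ E2 (T : E2 →ₗ[ℝ] E2)

/-- The determinant of a 2×2 real matrix. -/
noncomputable def detM2 (T : M2) : ℝ := LinearMap.det (T : E2 →ₗ[ℝ] E2)

noncomputable def toMat (T : M2) : Matrix (Fin 2) (Fin 2) ℝ :=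
  LinearMap.toMatrixAlgEquiv (EuclideanSpace.basisFun (Fin 2) ℝ).toBasis (T : E2 →ₗ[ℝ] E2)

lemma toMat_inj {X Y : M2} (h : toMat X = toMat Y) : X = Y := by
  unfold toMat at h
  exact ContinuousLinearMap.coe_injective ((LinearMap.toMatrixAlgEquiv _).injective h)

lemma toMat_add (X Y : M2) : toMat (X + Y) = toMat X + toMat Y := by
  simp [toMat]
lemma toMat_sub (X Y : M2) : toMat (X - Y) = toMat X - toMat Y := by
  simp [toMat]
lemma toMat_smul (c : ℝ) (X : M2) : toMat (c • X) = c • toMat X := by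
  simp [toMat]
lemma toMat_mul (X Y : M2) : toMat (X * Y) = toMat X * toMat Y := by
  unfold toMat
  rw [← map_mul]; rfl
lemma toMat_one : toMat 1 = 1 := by
  unfold toMat
  rw [← map_one (LinearMap.toMatrixAlgEquiv (EuclideanSpace.basisFun (Fin 2) ℝ).toBasis)]; rfl
lemma trM2_eq (X : M2) : trM2 X = (toMat X).trace :=
  LinearMap.trace_eq_matrix_trace ℝ (EuclideanSpace.basisFun (Fin 2) ℝ).toBasis _
lemma detM2_eq (X : M2) : detM2 X = (toMat X).det :=
  (LinearMap.det_toMatrix (EuclideanSpace.basisFun (Fin 2) ℝ).toBasis _).symm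

noncomputable def trL : M2 →L[ℝ] ℝ :=
  LinearMap.toContinuousLinearMap
    ((LinearMap.trace ℝ E2).comp (ContinuousLinearMap.coeLM ℝ))

lemma trL_apply (X : M2) : trL X = trM2 X := rfl

lemma trM2_comm (X Y : M2) : trM2 (X * Y) = trM2 (Y * X) := by
  rw [trM2_eq, trM2_eq, toMat_mul, toMat_mul, Matrix.trace_mul_comm]
lemma trM2_one : trM2 1 = 2 := by
  rw [trM2_eq, toMat_one]; simp

lemma cayley (X : M2) : X * X = trM2 X • X - detM2 X • 1 := by
  apply toMat_inj
  rw [trM2_eq, detM2_eq, toMat_sub, toMat_smul, toMat_smul, toMat_mul, toMat_one]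
  generalize toMat X = P
  ext i j
  fin_cases i <;> fin_cases j <;>
    simp [Matrix.mul_apply, Matrix.trace, Matrix.det_fin_two, Fin.sum_univ_two] <;> ring

lemma cayley2 (X Y : M2) : X * Y + Y * X =
    trM2 X • Y + trM2 Y • X + (trM2 (X * Y) - trM2 X * trM2 Y) • 1 := by
  apply toMat_inj
  rw [trM2_eq, trM2_eq, trM2_eq]
  simp only [toMat_add, toMat_smul, toMat_mul, toMat_one]
  generalize toMat X = P
  generalize toMat Y = Q
  ext i j
  fin_cases i <;> fin_cases j <;>
    simp [Matrix.mul_apply, Matrix.trace, Fin.sum_univ_two] <;> ring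

lemma sm_mul (c : ℝ) (X Y : M2) : (c • X) * Y = c • (X * Y) := by
  ext v; rfl
lemma mul_sm (c : ℝ) (X Y : M2) : X * (c • Y) = c • (X * Y) := by
  ext1 v
  exact X.map_smul c (Y v)

lemma neg_mulM (X Y : M2) : (-X) * Y = -(X * Y) := by
  ext v; rfl

lemma zero_smM (X : M2) : (0 : ℝ) • X = 0 := by
  module

lemma norm_one_M2 : ‖(1 : M2)‖ ≤ 1 := ContinuousLinearMap.norm_id_le

lemma gron {C : ℝ} (hC : 0 < C) (Φ Φ' : ℝ → M2) (h0 : Φ 0 = 1)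
    (h : ∀ t, HasDerivAt Φ (Φ' t) t) (hb : ∀ t, ‖Φ' t‖ ≤ C * ‖Φ t‖) :
    ∀ t ∈ Icc (0:ℝ) 1, ‖Φ t‖ ≤ Real.exp C := by
  intro t ht
  have := norm_le_gronwallBound_of_norm_deriv_right_le (f := Φ) (f' := Φ') (δ := 1) (K := C)
    (ε := 0) (a := 0) (b := 1)
    (fun t _ => (h t).continuousAt.continuousWithinAt) (fun t _ => (h t).hasDerivWithinAt)
    (by rw [h0]; exact norm_one_M2) (fun t _ => by simpa using hb t) t ht
  rw [gronwallBound_ε0] at this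
  refine this.trans ?_
  rw [one_mul]
  apply Real.exp_le_exp.2
  nlinarith [ht.2]

lemma smooth_sol (A Φ : ℝ → M2) (hA : ContDiff ℝ (⊤ : ℕ∞) A)
    (h : ∀ t, HasDerivAt Φ (A t * Φ t) t) : ContDiff ℝ (⊤ : ℕ∞) Φ := by
  rw [contDiff_infty]
  intro n
  induction n with
  | zero =>
    exact contDiff_zero.2 (continuous_iff_continuousAt.2 fun t => (h t).continuousAt)
  | succ n ih =>
    have hd : deriv Φ = fun t => A t * Φ t := funext fun t => (h t).deriv
    push_cast
    rw [contDiff_succ_iff_deriv]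
    refine ⟨fun t => (h t).differentiableAt, by simp, ?_⟩
    rw [hd]
    exact ((contDiff_infty.1 hA) n).mul ih

lemma chi_deriv_zero (t : ℝ) (ht : t ∉ Ioo (0:ℝ) 1) : deriv Real.smoothTransition t = 0 := by
  by_cases h0 : t ≤ 0
  · apply IsLocalMin.deriv_eq_zero
    refine Filter.Eventually.of_forall fun s => ?_
    show Real.smoothTransition t ≤ _
    rw [Real.smoothTransition.zero_of_nonpos h0]
    exact Real.smoothTransition.nonneg s
  · have h1 : 1 ≤ t := by
      by_contra h; exact ht ⟨not_le.1 h0, not_le.1 h⟩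
    apply IsLocalMax.deriv_eq_zero
    refine Filter.Eventually.of_forall fun s => ?_
    show _ ≤ Real.smoothTransition t
    rw [Real.smoothTransition.one_of_one_le h1]
    exact Real.smoothTransition.le_one s

lemma chi_smooth : ContDiff ℝ (⊤ : ℕ∞) Real.smoothTransition := Real.smoothTransition.contDiff

lemma chi_deriv_smooth : ContDiff ℝ (⊤ : ℕ∞) (deriv Real.smoothTransition) :=
  (contDiff_infty_iff_deriv.1 chi_smooth).2

lemma chi_bound : ∃ M : ℝ, 0 ≤ M ∧ ∀ t ∈ Icc (0:ℝ) 1, |deriv Real.smoothTransition t| ≤ M := by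
  obtain ⟨M, hM⟩ := (isCompact_Icc (a := (0:ℝ)) (b := 1)).exists_bound_of_continuousOn
    chi_deriv_smooth.continuous.continuousOn
  exact ⟨M, (norm_nonneg _).trans (hM 0 (by simp)), hM⟩

lemma path_deriv (N : M2) (τ : ℝ) (hN : N * N = τ • N + τ • 1) (χ : ℝ → ℝ) (c' t : ℝ)
    (hχ : HasDerivAt χ c' t) (hd : 0 < 1 + τ * (χ t * (1 - χ t))) :
    HasDerivAt (fun s => (Real.sqrt (1 + τ * (χ s * (1 - χ s))))⁻¹ • (1 + χ s • N))
      (((c' / (1 + τ * (χ t * (1 - χ t)))) • (N - (τ / 2) • 1)) *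
        ((Real.sqrt (1 + τ * (χ t * (1 - χ t))))⁻¹ • (1 + χ t • N))) t := by
  have h1 : HasDerivAt (fun s => 1 + τ * (χ s * (1 - χ s))) (τ * (c' * (1 - χ t) + χ t * (-c'))) t :=
    ((hχ.mul (hχ.const_sub 1)).const_mul τ).const_add 1
  have h2 := (h1.sqrt hd.ne').inv (Real.sqrt_pos.2 hd).ne'
  have h3 : HasDerivAt (fun s => (1 : M2) + χ s • N) (c' • N) t :=
    (hχ.smul_const N).const_add 1
  have h4 := h2.smul h3
  refine h4.congr_deriv ?_
  have hs := Real.sqrt_pos.2 hd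
  have hsq := Real.sq_sqrt hd.le
  simp only [Pi.inv_apply]
  set r := Real.sqrt (1 + τ * (χ t * (1 - χ t))) with hr
  rw [← hsq]
  have hm : (N - (τ / 2) • 1) * (1 + χ t • N) =
      (1 + τ * χ t / 2) • N + (-τ / 2 + τ * χ t) • (1 : M2) := by
    simp only [sub_mul, mul_add, mul_one, one_mul, sm_mul, mul_sm, hN]
    module
  rw [sm_mul, mul_sm, hm]
  have e1 : r⁻¹ * c' + (-(τ * (c' * (1 - χ t) + χ t * -c') / (2 * r)) / r ^ 2) * χ t
      = c' / r ^ 2 * r⁻¹ * (1 + τ * χ t / 2) := by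
    field_simp
    rw [hsq]; ring
  have e2 : (-(τ * (c' * (1 - χ t) + χ t * -c') / (2 * r)) / r ^ 2)
      = c' / r ^ 2 * r⁻¹ * (-τ / 2 + τ * χ t) := by
    field_simp
    ring
  have e3 : (c' / r ^ 2) • r⁻¹ • ((1 + τ * χ t / 2) • N + (-τ / 2 + τ * χ t) • (1 : M2))
      = (c' / r ^ 2 * r⁻¹ * (1 + τ * χ t / 2)) • N
        + (c' / r ^ 2 * r⁻¹ * (-τ / 2 + τ * χ t)) • (1 : M2) := by module
  rw [e3, ← e1, ← e2]
  module

set_option maxHeartbeats 1000000 in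
/-- Perturbation lemma for traceless linear variational equations (right composition):
given `C, ε > 0`, there is `δ > 0` such that for any smooth traceless `A : ℝ → M₂(ℝ)`
with `‖A(t)‖ ≤ C`, and any `S ∈ SL(2,ℝ)` with `‖S − I‖ ≤ δ`, there is a smooth
traceless `B` which is `ε`-close to `A`, coincides with `A` outside `(0,1)`, and whose
fundamental solution satisfies `Φ_B(1) = Φ_A(1)·S`. -/
theorem perturbation_lemma_right (C : ℝ) (hC : 0 < C) (ε : ℝ) (hε : 0 < ε) :
    ∃ δ : ℝ, 0 < δ ∧
      ∀ A : ℝ → M2, ContDiff ℝ (⊤ : ℕ∞) A → (∀ t : ℝ, trM2 (A t) = 0) →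
        (∀ t : ℝ, ‖A t‖ ≤ C) →
      ∀ S : M2, detM2 S = 1 → ‖S - 1‖ ≤ δ →
      ∀ ΦA : ℝ → M2, ΦA 0 = 1 → (∀ t : ℝ, HasDerivAt ΦA (A t * ΦA t) t) →
      ∃ B : ℝ → M2, ContDiff ℝ (⊤ : ℕ∞) B ∧ (∀ t : ℝ, trM2 (B t) = 0) ∧
        (∀ t : ℝ, ‖A t - B t‖ ≤ ε) ∧
        (∀ t : ℝ, t ∉ Set.Ioo (0 : ℝ) 1 → A t = B t) ∧
        ∃ ΦB : ℝ → M2, ΦB 0 = 1 ∧ (∀ t : ℝ, HasDerivAt ΦB (B t * ΦB t) t) ∧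
          ΦB 1 = ΦA 1 * S := by
  obtain ⟨M, hM0, hM⟩ := chi_bound
  set κ := ‖trL‖ with hκ
  have hκ0 : 0 ≤ κ := by
    rw [hκ]; exact norm_nonneg trL
  set L := 2 * M * Real.exp C * Real.exp C * (1 + κ / 2) with hL
  have hL0 : 0 ≤ L := by positivity
  refine ⟨min (2 / (κ + 1)) (ε / (L + 1)), by positivity, ?_⟩
  intro A hA htr hAC S hS hSδ ΦA h0 hΦ
  set N := S - 1 with hNdef
  set τ := trM2 N with hτ
  have hN1 : ‖N‖ ≤ 2 / (κ + 1) := hSδ.trans (min_le_left _ _)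
  have hN2 : ‖N‖ ≤ ε / (L + 1) := hSδ.trans (min_le_right _ _)
  have hτκ : |τ| ≤ κ * ‖N‖ := trL.le_opNorm N
  have hτ2 : |τ| ≤ 2 := by
    rw [le_div_iff₀ (by positivity)] at hN1
    nlinarith [norm_nonneg N]
  have hSN : S = N + 1 := by simp [hNdef]
  have hNN : N * N = τ • N + τ • 1 := by
    have h1 := cayley S
    have h2 : trM2 S = τ + 2 := by
      rw [hSN, ← trL_apply, map_add, trL_apply, trL_apply, trM2_one]
    rw [hS, h2, hSN] at h1
    have h3 : (N + 1) * (N + 1) = N * N + (2:ℝ) • N + 1 := by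
      rw [add_mul, mul_add]; simp only [mul_one, one_mul]; module
    rw [h3] at h1
    have : N * N = ((τ + 2) • (N + 1) - (1:ℝ) • 1) - (2:ℝ) • N - 1 := by
      rw [← h1]; abel
    rw [this]; module
  set χ := Real.smoothTransition with hχ
  set d : ℝ → ℝ := fun s => 1 + τ * (χ s * (1 - χ s)) with hd
  have hχ0 : ∀ s, 0 ≤ χ s := Real.smoothTransition.nonneg
  have hχ1 : ∀ s, χ s ≤ 1 := Real.smoothTransition.le_one
  have hd2 : ∀ s, 1 / 2 ≤ d s := by
    intro s
    have h1 : 0 ≤ χ s * (1 - χ s) := mul_nonneg (hχ0 s) (by linarith [hχ1 s])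
    have h2 : χ s * (1 - χ s) ≤ 1 / 4 := by nlinarith [sq_nonneg (χ s - 1 / 2)]
    have h3 := (abs_le.1 hτ2).1
    show 1 / 2 ≤ 1 + τ * (χ s * (1 - χ s))
    nlinarith
  set Ψ : ℝ → M2 := fun t => trM2 (ΦA t) • 1 - ΦA t with hΨ
  have hΨ0 : Ψ 0 = 1 := by
    simp only [hΨ, h0, trM2_one]; module
  have hΨd : ∀ t, HasDerivAt Ψ (-(Ψ t * A t)) t := by
    intro t
    have h1 : HasDerivAt (fun s => trM2 (ΦA s)) (trM2 (A t * ΦA t)) t :=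
      trL.hasFDerivAt.comp_hasDerivAt t (hΦ t)
    refine ((h1.smul_const (1 : M2)).sub (hΦ t)).congr_deriv ?_
    have h2 := cayley2 (A t) (ΦA t)
    rw [htr t] at h2
    simp only [hΨ, sub_mul, sm_mul, one_mul]
    have h3 : ΦA t * A t = trM2 (ΦA t) • A t + trM2 (A t * ΦA t) • 1 - A t * ΦA t := by
      rw [eq_sub_iff_add_eq, add_comm, h2]; module
    rw [h3]; abel
  have hΨΦ : ∀ t, Ψ t * ΦA t = 1 := by
    intro t
    have hder : ∀ s, HasDerivAt (fun s => Ψ s * ΦA s) 0 s := by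
      intro s
      refine ((hΨd s).mul (hΦ s)).congr_deriv ?_
      rw [neg_mulM, mul_assoc, neg_add_cancel]
    have := is_const_of_deriv_eq_zero (fun s => (hder s).differentiableAt)
      (fun s => (hder s).deriv) t 0
    simpa [hΨ0, h0] using this
  have hΦb := gron hC ΦA _ h0 hΦ (fun t => (norm_mul_le _ _).trans
    (mul_le_mul_of_nonneg_right (hAC t) (norm_nonneg _)))
  have hΨb := gron hC Ψ _ hΨ0 hΨd (fun t => by
    rw [norm_neg, mul_comm C]
    exact (norm_mul_le _ _).trans (mul_le_mul_of_nonneg_left (hAC t) (norm_nonneg _)))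
  have hΦs : ContDiff ℝ (⊤ : ℕ∞) ΦA := smooth_sol A ΦA hA hΦ
  have hΨs : ContDiff ℝ (⊤ : ℕ∞) Ψ :=
    ((trL.contDiff.comp hΦs).smul contDiff_const).sub hΦs
  have hds : ContDiff ℝ (⊤ : ℕ∞) d :=
    contDiff_const.add (contDiff_const.mul (chi_smooth.mul (contDiff_const.sub chi_smooth)))
  set K : M2 := N - (τ / 2) • 1 with hK
  have htrK : trM2 K = 0 := by
    rw [← trL_apply, hK, map_sub, map_smul, trL_apply, trL_apply, trM2_one, smul_eq_mul]
    ring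
  have hKn : ‖K‖ ≤ (1 + κ / 2) * ‖N‖ := by
    have h1 : ‖(τ / 2) • (1 : M2)‖ ≤ |τ| / 2 := by
      rw [norm_smul, Real.norm_eq_abs, abs_div, abs_two]
      nlinarith [norm_one_M2, abs_nonneg τ]
    have := norm_sub_le N ((τ / 2) • (1 : M2))
    nlinarith
  refine ⟨fun t => A t + (deriv χ t / d t) • (ΦA t * K * Ψ t), ?_, ?_, ?_, ?_, ?_⟩
  · exact hA.add ((chi_deriv_smooth.div hds (fun s => by linarith [hd2 s] |> ne_of_gt)).smul
      ((hΦs.mul contDiff_const).mul hΨs))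
  · intro t
    have h1 : trM2 (ΦA t * K * Ψ t) = 0 := by
      rw [trM2_comm, ← mul_assoc, hΨΦ, one_mul, htrK]
    rw [← trL_apply, map_add, map_smul, trL_apply, trL_apply, h1, htr]; simp
  · intro t
    by_cases ht : t ∈ Ioo (0:ℝ) 1
    · have ht' := Ioo_subset_Icc_self ht
      have h1 : ‖ΦA t * K * Ψ t‖ ≤ Real.exp C * ((1 + κ / 2) * ‖N‖) * Real.exp C := by
        refine (norm_mul_le _ _).trans (mul_le_mul ((norm_mul_le _ _).trans
          (mul_le_mul (hΦb t ht') hKn (norm_nonneg _) (by positivity)))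
          (hΨb t ht') (norm_nonneg _) (by positivity))
      have h2 : |deriv χ t / d t| ≤ 2 * M := by
        have hp : 0 < d t := by linarith [hd2 t]
        rw [abs_div, abs_of_pos hp, div_le_iff₀ hp]
        nlinarith [hM t ht', hd2 t]
      have h3 : ‖A t - (A t + (deriv χ t / d t) • (ΦA t * K * Ψ t))‖ ≤ L * ‖N‖ := by
        rw [sub_add_cancel_left, norm_neg, norm_smul, Real.norm_eq_abs]
        refine (mul_le_mul h2 h1 (norm_nonneg _) (by positivity)).trans (le_of_eq ?_)
        rw [hL]; ring
      refine h3.trans ?_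
      rw [le_div_iff₀ (by positivity)] at hN2
      have hn := norm_nonneg N
      clear_value L
      calc L * ‖N‖ ≤ ‖N‖ * (L + 1) := by linarith
        _ ≤ ε := hN2
    · simp [hχ, chi_deriv_zero t ht, zero_smM, hε.le]
  · intro t ht
    simp [hχ, chi_deriv_zero t ht, zero_smM]
  · have e0 : χ 0 = 0 := Real.smoothTransition.zero
    have e1 : χ 1 = 1 := Real.smoothTransition.one
    refine ⟨fun t => ΦA t * ((Real.sqrt (d t))⁻¹ • (1 + χ t • N)), ?_, ?_, ?_⟩
    · simp [hd, e0, h0, zero_smM]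
    · intro t
      have hG := path_deriv N τ hNN χ (deriv χ t) t
        ((chi_smooth.differentiable (by simp)) t).hasDerivAt
        (by have := hd2 t; simp only [hd] at this; linarith)
      refine ((hΦ t).mul hG).congr_deriv ?_
      have h1 : ΦA t * K * Ψ t * (ΦA t * ((Real.sqrt (d t))⁻¹ • (1 + χ t • N))) =
          ΦA t * (K * ((Real.sqrt (d t))⁻¹ • (1 + χ t • N))) := by
        rw [← mul_assoc _ (ΦA t), mul_assoc _ (Ψ t), hΨΦ, mul_one, mul_assoc]
      show A t * ΦA t * ((Real.sqrt (d t))⁻¹ • (1 + χ t • N)) +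
          ΦA t * (((deriv χ t / d t) • K) * ((Real.sqrt (d t))⁻¹ • (1 + χ t • N))) =
        (A t + (deriv χ t / d t) • (ΦA t * K * Ψ t)) *
          (ΦA t * ((Real.sqrt (d t))⁻¹ • (1 + χ t • N)))
      rw [add_mul, sm_mul _ (ΦA t * K * Ψ t), h1, sm_mul _ K, mul_sm (deriv χ t / d t), mul_assoc]
    · simp only [hd, e1]
      rw [hSN]
      simp [add_comm]
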